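/- The decreasing rearrangement is continuous in the ℓ² norm: for any two decreasing summable sequences of nonnegative reals obtained as the decreasingly ordered eigenvalues of positive trace-class operators X and Y, the ℓ² distance between the rearranged sequences is at most the Hilbert–Schmidt norm of X - Y. -/

import Mathlib

/-- Parseval's identity in extended nonnegative reals. -/
theorem HilbertBasis.tsum_enorm_inner_sq {ι 𝕜 H : Type*} [RCLike 𝕜] [NormedAddCommGroup H]
    [InnerProductSpace 𝕜 H] (b : HilbertBasis ι 𝕜 H) (v : H) :
    ∑' i, ‖inner 𝕜 (b i) v‖ₑ ^ 2 = ‖v‖ₑ ^ 2 := by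
  have h := b.hasSum_inner_mul_inner v v
  have h1 : HasSum (fun i => ‖inner 𝕜 (b i) v‖ ^ 2) (‖v‖ ^ 2) := by
    have h2 := RCLike.hasSum_re 𝕜 h
    rw [inner_self_eq_norm_sq] at h2
    convert h2 using 2 with i
    rw [← inner_conj_symm v (b i), RCLike.conj_mul, ← RCLike.ofReal_pow, RCLike.ofReal_re]
  have key : ∀ t : ℝ, 0 ≤ t → ENNReal.ofReal (t ^ 2) = ENNReal.ofReal t ^ 2 := fun t ht =>
    ENNReal.ofReal_pow ht 2
  rw [← ofReal_norm, ← key _ (norm_nonneg _), ← h1.tsum_eq,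
    ENNReal.ofReal_tsum_of_nonneg (fun i => by positivity) h1.summable]
  refine tsum_congr fun i => ?_
  rw [← ofReal_norm, key _ (norm_nonneg _)]

/-- The Hilbert–Schmidt norm of an operator, computed in one basis, is given by the matrix
coefficients in any two bases. -/
theorem HilbertBasis.tsum_enorm_apply_sq {ι κ ν 𝕜 H : Type*} [RCLike 𝕜] [NormedAddCommGroup H]
    [InnerProductSpace 𝕜 H] [CompleteSpace H] (e : HilbertBasis ι 𝕜 H) (b : HilbertBasis κ 𝕜 H)
    (c : HilbertBasis ν 𝕜 H) (T : H →L[𝕜] H) (hT : IsSelfAdjoint T) :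
    ∑' k, ‖T (e k)‖ₑ ^ 2 = ∑' i, ∑' j, ‖inner 𝕜 (c j) (T (b i))‖ₑ ^ 2 := by
  have hsymm := hT.isSymmetric
  simp_rw [c.tsum_enorm_inner_sq, ← b.tsum_enorm_inner_sq (T (e _)),
    ← e.tsum_enorm_inner_sq (T (b _))]
  rw [ENNReal.tsum_comm]
  refine tsum_congr fun i => tsum_congr fun k => ?_
  have h : inner 𝕜 (b i) (T (e k)) = inner 𝕜 (T (b i)) (e k) := (hsymm (b i) (e k)).symm
  rw [h, ← ofReal_norm, ← ofReal_norm, norm_inner_symm]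

/-- A sequence decreasing to zero is a superposition of indicators of initial segments. -/
theorem Antitone.tsum_ite_sub_succ {u : ℕ → ℝ} (hu : Antitone u)
    (h0 : Filter.Tendsto u Filter.atTop (nhds 0)) (i : ℕ) :
    ∑' m, (if i ≤ m then ENNReal.ofReal (u m - u (m + 1)) else 0) = ENNReal.ofReal (u i) := by
  have hnn : ∀ m, 0 ≤ (if i ≤ m then u m - u (m + 1) else 0) := fun m => by
    split_ifs
    · exact sub_nonneg.2 (hu m.le_succ)
    · exact le_rfl
  have hpart : ∀ n, ∑ m ∈ Finset.range n, (if i ≤ m then u m - u (m + 1) else 0)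
      = u i - u (max i n) := fun n => by
    induction n with
    | zero => simp
    | succ n ih =>
      rw [Finset.sum_range_succ, ih]
      split_ifs with h
      · rw [max_eq_right h, max_eq_right (h.trans n.le_succ)]; ring
      · rw [max_eq_left (by omega), max_eq_left (by omega)]; ring
  have hs : HasSum (fun m => if i ≤ m then u m - u (m + 1) else 0) (u i) := by
    rw [hasSum_iff_tendsto_nat_of_nonneg hnn]
    simp_rw [hpart]
    have hmax : Filter.Tendsto (fun n => max i n) Filter.atTop Filter.atTop :=
      Filter.tendsto_atTop_mono (fun n => le_max_right i n) Filter.tendsto_id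
    simpa using (h0.comp hmax).const_sub (u i)
  rw [← hs.tsum_eq, ENNReal.ofReal_tsum_of_nonneg hnn hs.summable]
  refine tsum_congr fun m => ?_
  split_ifs <;> simp

/-- If the partial sums of `w` are bounded by those of `v`, then so are the sums weighted by a
sequence decreasing to zero. -/
theorem Antitone.tsum_ofReal_mul_le {u : ℕ → ℝ} (hu : Antitone u)
    (h0 : Filter.Tendsto u Filter.atTop (nhds 0)) {w v : ℕ → ENNReal}
    (h : ∀ m, ∑' i, (if i ≤ m then w i else 0) ≤ ∑' i, (if i ≤ m then v i else 0)) :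
    ∑' i, ENNReal.ofReal (u i) * w i ≤ ∑' i, ENNReal.ofReal (u i) * v i := by
  have key : ∀ w : ℕ → ENNReal, ∑' i, ENNReal.ofReal (u i) * w i
      = ∑' m, ENNReal.ofReal (u m - u (m + 1)) * ∑' i, (if i ≤ m then w i else 0) := fun w => by
    simp_rw [← hu.tsum_ite_sub_succ h0, ← ENNReal.tsum_mul_right, ← ENNReal.tsum_mul_left]
    rw [ENNReal.tsum_comm]
    refine tsum_congr fun m => tsum_congr fun i => ?_
    split_ifs <;> simp
  rw [key, key]
  exact ENNReal.tsum_le_tsum fun m => mul_le_mul_right (h m) _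

/-- The rearrangement inequality for doubly stochastic weights. -/
theorem Antitone.tsum_mul_doublyStochastic_le {x y : ℕ → ℝ} (hx : Antitone x) (hy : Antitone y)
    (hx0 : Filter.Tendsto x Filter.atTop (nhds 0)) (hy0 : Filter.Tendsto y Filter.atTop (nhds 0))
    {p : ℕ → ℕ → ENNReal} (hrow : ∀ i, ∑' j, p i j ≤ 1) (hcol : ∀ j, ∑' i, p i j ≤ 1) :
    ∑' i, ENNReal.ofReal (x i) * ∑' j, ENNReal.ofReal (y j) * p i j
      ≤ ∑' k, ENNReal.ofReal (x k) * ENNReal.ofReal (y k) := by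
  refine hx.tsum_ofReal_mul_le hx0 fun m => ?_
  have hl : ∑' i, (if i ≤ m then ∑' j, ENNReal.ofReal (y j) * p i j else 0)
      = ∑' j, ENNReal.ofReal (y j) * ∑' i, (if i ≤ m then p i j else 0) := by
    simp_rw [← ENNReal.tsum_mul_left]
    rw [ENNReal.tsum_comm]
    refine tsum_congr fun i => ?_
    split_ifs <;> simp
  have hr : ∑' i, (if i ≤ m then ENNReal.ofReal (y i) else 0)
      = ∑' i, ENNReal.ofReal (y i) * (if i ≤ m then 1 else 0) := by simp
  rw [hl, hr]
  refine hy.tsum_ofReal_mul_le hy0 fun n => ?_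
  rcases le_total n m with hnm | hmn
  · refine ENNReal.tsum_le_tsum fun j => ?_
    split_ifs with h1 h2
    · refine le_trans (ENNReal.tsum_le_tsum fun i => ?_) (hcol j)
      split_ifs <;> simp
    · exact absurd (h1.trans hnm) h2
    · exact le_rfl
  · have hswap : ∑' j, (if j ≤ n then ∑' i, (if i ≤ m then p i j else 0) else 0)
        ≤ ∑' i, (if i ≤ m then ∑' j, p i j else 0) := by
      calc _ ≤ ∑' j, ∑' i, (if i ≤ m then p i j else 0) :=
            ENNReal.tsum_le_tsum fun j => by split_ifs <;> simp
        _ = _ := by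
            rw [ENNReal.tsum_comm]
            refine tsum_congr fun i => ?_
            split_ifs <;> simp
    refine hswap.trans (ENNReal.tsum_le_tsum fun i => ?_)
    split_ifs with h1 h2
    · exact hrow i
    · exact absurd (h1.trans hmn) h2
    · exact zero_le
    · exact le_rfl

/-- Expansion of a squared difference, arranged without subtraction. -/
theorem ENNReal.ofReal_sub_sq_add {a b : ℝ} (ha : 0 ≤ a) (hb : 0 ≤ b) :
    ENNReal.ofReal ((a - b) ^ 2) + 2 * (ENNReal.ofReal a * ENNReal.ofReal b)
      = ENNReal.ofReal (a ^ 2) + ENNReal.ofReal (b ^ 2) := by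
  rw [← ENNReal.ofReal_mul ha, ← ENNReal.ofReal_ofNat 2, ← ENNReal.ofReal_mul (by norm_num),
    ← ENNReal.ofReal_add (by positivity) (by positivity),
    ← ENNReal.ofReal_add (by positivity) (by positivity)]
  congr 1
  ring

/-- A weighted form of the Hoffman–Wielandt inequality for doubly stochastic weights. -/
theorem Antitone.tsum_sub_sq_le_doublyStochastic {x y : ℕ → ℝ} (hx : Antitone x)
    (hy : Antitone y) (hx_nonneg : ∀ k, 0 ≤ x k) (hy_nonneg : ∀ k, 0 ≤ y k)
    (hx0 : Filter.Tendsto x Filter.atTop (nhds 0)) (hy0 : Filter.Tendsto y Filter.atTop (nhds 0))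
    (hfin : ∑' k, ENNReal.ofReal (x k) * ENNReal.ofReal (y k) ≠ ⊤)
    {p : ℕ → ℕ → ENNReal} (hrow : ∀ i, ∑' j, p i j = 1) (hcol : ∀ j, ∑' i, p i j = 1) :
    ∑' k, ENNReal.ofReal ((x k - y k) ^ 2)
      ≤ ∑' i, ∑' j, ENNReal.ofReal ((x i - y j) ^ 2) * p i j := by
  have hmul := hx.tsum_mul_doublyStochastic_le hy hx0 hy0 (fun i => (hrow i).le)
    (fun j => (hcol j).le)
  have hdiag : ∑' k, ENNReal.ofReal ((x k - y k) ^ 2)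
        + 2 * ∑' k, ENNReal.ofReal (x k) * ENNReal.ofReal (y k)
      = ∑' k, ENNReal.ofReal (x k ^ 2) + ∑' k, ENNReal.ofReal (y k ^ 2) := by
    rw [← ENNReal.tsum_mul_left, ← ENNReal.tsum_add, ← ENNReal.tsum_add]
    exact tsum_congr fun k => ENNReal.ofReal_sub_sq_add (hx_nonneg k) (hy_nonneg k)
  have hfull : ∑' i, ∑' j, ENNReal.ofReal ((x i - y j) ^ 2) * p i j
        + 2 * ∑' i, ENNReal.ofReal (x i) * ∑' j, ENNReal.ofReal (y j) * p i j
      = ∑' k, ENNReal.ofReal (x k ^ 2) + ∑' k, ENNReal.ofReal (y k ^ 2) := by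
    have h1 : ∑' k, ENNReal.ofReal (x k ^ 2)
        = ∑' i, ∑' j, ENNReal.ofReal (x i ^ 2) * p i j :=
      tsum_congr fun i => by rw [ENNReal.tsum_mul_left, hrow, mul_one]
    have h2 : ∑' k, ENNReal.ofReal (y k ^ 2)
        = ∑' i, ∑' j, ENNReal.ofReal (y j ^ 2) * p i j := by
      rw [ENNReal.tsum_comm]
      exact tsum_congr fun i => by rw [ENNReal.tsum_mul_left, hcol, mul_one]
    rw [h1, h2]
    simp_rw [← ENNReal.tsum_mul_left, ← ENNReal.tsum_add]
    refine tsum_congr fun i => tsum_congr fun j => ?_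
    rw [← add_mul, ← ENNReal.ofReal_sub_sq_add (hx_nonneg i) (hy_nonneg j)]
    ring
  refine (ENNReal.add_le_add_iff_right (ENNReal.mul_ne_top
    (ENNReal.ofNat_ne_top (n := 2)) hfin)).1 ?_
  rw [hdiag, ← hfull]
  gcongr

/-- A nonnegative summable real sequence has summable squares. -/
theorem Summable.sq_of_nonneg {u : ℕ → ℝ} (hu : Summable u) (h : ∀ k, 0 ≤ u k) :
    Summable fun k => u k ^ 2 := by
  have := hu.mul_of_nonneg hu h h
  simp_rw [sq]
  exact this.comp_injective (i := fun k : ℕ => (k, k)) fun a b hab => (Prod.mk.inj hab).1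

/-- Continuity of the decreasing rearrangement in the ℓ² norm: if `X` and `Y` are positive
trace-class operators on a separable Hilbert space, with summable decreasing eigenvalue
sequences `x` and `y` (their decreasing rearrangements), then the ℓ² distance between
the rearranged eigenvalue sequences is at most the Hilbert–Schmidt norm of `X - Y`
(computed in any Hilbert basis `e`). -/
theorem decreasing_rearrangement_continuous_l2
    {H : Type*} [NormedAddCommGroup H] [InnerProductSpace ℂ H] [CompleteSpace H]
    (X Y : H →L[ℂ] H) (hXsa : IsSelfAdjoint X) (hYsa : IsSelfAdjoint Y)
    (x y : ℕ → ℝ)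
    (hx_nonneg : ∀ k, 0 ≤ x k) (hy_nonneg : ∀ k, 0 ≤ y k)
    (hx_dec : Antitone x) (hy_dec : Antitone y)
    (hx_sum : Summable x) (hy_sum : Summable y)
    (bX : HilbertBasis ℕ ℂ H) (hbX : ∀ k, X (bX k) = (x k : ℂ) • bX k)
    (bY : HilbertBasis ℕ ℂ H) (hbY : ∀ k, Y (bY k) = (y k : ℂ) • bY k)
    (e : HilbertBasis ℕ ℂ H) :
    Real.sqrt (∑' k, (x k - y k) ^ 2) ≤ Real.sqrt (∑' k, ‖(X - Y) (e k)‖ ^ 2) := by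
  have hx2 := hx_sum.sq_of_nonneg hx_nonneg
  have hy2 := hy_sum.sq_of_nonneg hy_nonneg
  set p : ℕ → ℕ → ENNReal := fun i j => ‖inner ℂ (bY j) (bX i)‖ₑ ^ 2 with hp
  have hrow : ∀ i, ∑' j, p i j = 1 := fun i => by
    rw [hp, bY.tsum_enorm_inner_sq, ← ofReal_norm, bX.orthonormal.1 i]; simp
  have hcol : ∀ j, ∑' i, p i j = 1 := fun j => by
    have : ∀ i, p i j = ‖inner ℂ (bX i) (bY j)‖ₑ ^ 2 := fun i => by
      simp only [hp]
      rw [← ofReal_norm, ← ofReal_norm, norm_inner_symm]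
    simp_rw [this]
    rw [bX.tsum_enorm_inner_sq, ← ofReal_norm, bY.orthonormal.1 j]; simp
  have hHS : ∑' k, ENNReal.ofReal (‖(X - Y) (e k)‖ ^ 2)
      = ∑' i, ∑' j, ENNReal.ofReal ((x i - y j) ^ 2) * p i j := by
    simp_rw [ENNReal.ofReal_pow (norm_nonneg _), ofReal_norm]
    rw [e.tsum_enorm_apply_sq bX bY _ (hXsa.sub hYsa)]
    refine tsum_congr fun i => tsum_congr fun j => ?_
    have hY : inner ℂ (bY j) (Y (bX i)) = inner ℂ (Y (bY j)) (bX i) :=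
      (hYsa.isSymmetric (bY j) (bX i)).symm
    have hcoef : inner ℂ (bY j) ((X - Y) (bX i))
        = ((x i - y j : ℝ) : ℂ) * inner ℂ (bY j) (bX i) := by
      rw [sub_apply, inner_sub_right, hY, hbX, hbY, inner_smul_right,
        inner_smul_left, Complex.conj_ofReal]
      push_cast
      ring
    rw [hcoef, enorm_mul, mul_pow, ← ofReal_norm, Complex.norm_real, Real.norm_eq_abs,
      ← ENNReal.ofReal_pow (abs_nonneg _), sq_abs]
  have hfinHS : ∑' k, ENNReal.ofReal (‖(X - Y) (e k)‖ ^ 2) ≠ ⊤ := by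
    have hbound : ∑' i, ∑' j, ENNReal.ofReal ((x i - y j) ^ 2) * p i j
        ≤ ∑' i, ∑' j, (ENNReal.ofReal (x i ^ 2) * p i j + ENNReal.ofReal (y j ^ 2) * p i j) := by
      refine ENNReal.tsum_le_tsum fun i => ENNReal.tsum_le_tsum fun j => ?_
      rw [← add_mul, ← ENNReal.ofReal_sub_sq_add (hx_nonneg i) (hy_nonneg j)]
      gcongr
      exact le_self_add
    rw [hHS]
    refine ne_top_of_le_ne_top ?_ hbound
    simp_rw [ENNReal.tsum_add]
    rw [ENNReal.tsum_comm (f := fun i j => ENNReal.ofReal (y j ^ 2) * p i j)]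
    simp_rw [ENNReal.tsum_mul_left, hrow, hcol, mul_one]
    exact ENNReal.add_ne_top.2 ⟨hx2.tsum_ofReal_ne_top, hy2.tsum_ofReal_ne_top⟩
  have hxy : ∑' k, ENNReal.ofReal (x k) * ENNReal.ofReal (y k) ≠ ⊤ := by
    have hs : Summable fun k => x k * y k :=
      (hx_sum.mul_of_nonneg hy_sum hx_nonneg hy_nonneg).comp_injective
        (i := fun k : ℕ => (k, k)) fun a b hab => (Prod.mk.inj hab).1
    simp_rw [← ENNReal.ofReal_mul (hx_nonneg _)]
    exact hs.tsum_ofReal_ne_top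
  have hmain := hx_dec.tsum_sub_sq_le_doublyStochastic hy_dec hx_nonneg hy_nonneg
    hx_sum.tendsto_atTop_zero hy_sum.tendsto_atTop_zero hxy hrow hcol
  rw [← hHS] at hmain
  refine Real.sqrt_le_sqrt ?_
  have htoReal : ∀ f : ℕ → ℝ, (∀ k, 0 ≤ f k) →
      (∑' k, ENNReal.ofReal (f k)).toReal = ∑' k, f k := fun f hf => by
    rw [ENNReal.tsum_toReal_eq fun k => ENNReal.ofReal_ne_top]
    exact tsum_congr fun k => ENNReal.toReal_ofReal (hf k)
  rw [← htoReal _ fun k => sq_nonneg _, ← htoReal _ fun k => sq_nonneg _]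
  exact ENNReal.toReal_mono hfinHS hmain
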